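/- arXiv:math/0107146 — 4 statements merged into one kernel-verified Lean document; each statement's English description precedes it below -/
import Mathlib

section
/- Let V(d) denote the Lebesgue volume of the open unit ball in d-dimensional Euclidean space ℝ^d, and let r_d = V(d)^{-1/d} be the radius for which the ball of radius r_d in ℝ^d has volume 1. Then for every positive integer d, the slab slice B(r_d) ∩ (ℝ^{d-1} × [-0.4, 0.4]) has volume at least 0.8; that is, the Lebesgue measure of the set of points x in the ball of radius r_d centred at the origin of ℝ^d whose last coordinate satisfies |x_d| ≤ 2/5 is at least 4/5. -/
open MeasureTheory Filter

/-- `V d` is the Lebesgue volume of the open unit ball in `d`-dimensional Euclidean space. -/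
noncomputable def V (d : ℕ) : ℝ :=
  (volume (Metric.ball (0 : EuclideanSpace ℝ (Fin d)) 1)).toReal

/-- `r d = V(d)^(-1/d)` is the radius for which the ball of radius `r d` in `ℝ^d`
has volume `1`. -/
noncomputable def r (d : ℕ) : ℝ := (V d) ^ (-(1 : ℝ) / d)

theorem slab (n : ℕ) (R a : ℝ) (hR : 0 ≤ R) :
    volume {x : EuclideanSpace ℝ (Fin (n+1)) | ‖x‖ < R ∧ |x (Fin.last n)| ≤ a} =
     ∫⁻ t in Set.Icc (-a) a, volume (Metric.ball (0 : EuclideanSpace ℝ (Fin n)) (Real.sqrt (R^2 - t^2))) := by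
  let S : Set (ℝ × (Fin n → ℝ)) := {p | p.1^2 + ∑ i, (p.2 i)^2 < R^2 ∧ |p.1| ≤ a}
  have hS : MeasurableSet S := by
    apply MeasurableSet.inter
    · exact measurableSet_lt (f := fun p : ℝ × (Fin n → ℝ) => p.1^2 + ∑ i, (p.2 i)^2) (by fun_prop) measurable_const
    · exact measurableSet_le (f := fun p : ℝ × (Fin n → ℝ) => |p.1|) (by fun_prop) measurable_const
  have mp := (volume_preserving_piFinSuccAbove (fun _ : Fin (n+1) => ℝ) (Fin.last n)).comp
    (PiLp.volume_preserving_ofLp (Fin (n+1)))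
  have e1 : {x : EuclideanSpace ℝ (Fin (n+1)) | ‖x‖ < R ∧ |x (Fin.last n)| ≤ a} =
     (⇑(MeasurableEquiv.piFinSuccAbove (fun _ : Fin (n+1) => ℝ) (Fin.last n)) ∘ WithLp.ofLp) ⁻¹' S := by
    ext x
    simp only [S, Set.mem_ofPred_eq, Set.mem_preimage, Function.comp]
    have : ‖x‖ < R ↔ ‖x‖^2 < R^2 := by
      rw [sq_lt_sq₀ (norm_nonneg _) hR]
    rw [this, EuclideanSpace.norm_sq_eq, Fin.sum_univ_castSucc]
    simp [MeasurableEquiv.piFinSuccAbove, Fin.insertNthEquiv, add_comm, Fin.init]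
  rw [e1, mp.measure_preimage hS.nullMeasurableSet]
  rw [Measure.volume_eq_prod, Measure.prod_apply hS, ← lintegral_indicator measurableSet_Icc]
  congr 1
  ext t
  by_cases ht : t ∈ Set.Icc (-a) a
  · rw [Set.indicator_of_mem ht]
    have hm : MeasurableSet (Prod.mk t ⁻¹' S) := measurable_prodMk_left hS
    rw [← (PiLp.volume_preserving_ofLp (Fin n)).measure_preimage hm.nullMeasurableSet]
    congr 1
    ext y
    have : |t| ≤ a := abs_le.2 ht
    simp only [S, Set.mem_ofPred_eq, Set.mem_preimage, this, and_true, Metric.mem_ball, dist_zero_right]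
    rw [Real.lt_sqrt (norm_nonneg _), EuclideanSpace.norm_sq_eq]
    simp only [Real.norm_eq_abs, sq_abs]
    constructor <;> intro h <;> linarith
  · rw [Set.indicator_of_notMem ht]
    have : ¬ |t| ≤ a := fun h => ht (abs_le.1 h)
    have : Prod.mk t ⁻¹' S = ∅ := by
      ext y; simp [S, this]
    simp [this]

theorem slab2 (n : ℕ) (hn : 1 ≤ n) (R a : ℝ) (hR : 0 ≤ R) (ha : 0 ≤ a) :
    volume {x : EuclideanSpace ℝ (Fin (n+1)) | ‖x‖ < R ∧ |x (Fin.last n)| ≤ a} =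
     ENNReal.ofReal (V n * ∫ t in (-a)..a, (Real.sqrt (R^2 - t^2))^n) := by
  have : Nonempty (Fin n) := ⟨⟨0, hn⟩⟩
  rw [slab n R a hR, intervalIntegral.integral_of_le (by linarith), ← integral_Icc_eq_integral_Ioc,
    ← integral_const_mul, ofReal_integral_eq_lintegral_ofReal]
  · congr 1
    ext t
    rw [Measure.addHaar_ball _ _ (Real.sqrt_nonneg _), mul_comm, ENNReal.ofReal_mul (by unfold V; positivity)]
    congr 1
    · unfold V
      rw [ENNReal.ofReal_toReal measure_ball_lt_top.ne]
    · simp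
  · exact (Continuous.continuousOn (by fun_prop)).integrableOn_compact isCompact_Icc
  · filter_upwards with t
    have : 0 ≤ V n := by unfold V; positivity
    simp only [Pi.zero_apply]
    positivity

theorem V_eq (d : ℕ) (hd : 1 ≤ d) : V d = Real.sqrt Real.pi ^ d / Real.Gamma (d / 2 + 1) := by
  have : Nonempty (Fin d) := ⟨⟨0, hd⟩⟩
  have : 0 < Real.Gamma (d / 2 + 1) := Real.Gamma_pos_of_pos (by positivity)
  unfold V
  rw [EuclideanSpace.volume_ball]
  simp
  positivity

theorem V_pos (d : ℕ) (hd : 1 ≤ d) : 0 < V d := by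
  have : 0 < Real.Gamma (d / 2 + 1) := Real.Gamma_pos_of_pos (by positivity)
  rw [V_eq d hd]
  have := Real.pi_pos
  positivity

theorem r_pos (d : ℕ) (hd : 1 ≤ d) : 0 < r d := Real.rpow_pos_of_pos (V_pos d hd) _

theorem V_mul (d : ℕ) (hd : 1 ≤ d) : V d * r d ^ d = 1 := by
  have h := V_pos d hd
  unfold r
  rw [← Real.rpow_natCast, ← Real.rpow_mul h.le]
  have : (-(1:ℝ) / d * d) = -1 := by field_simp
  rw [this, Real.rpow_neg_one]
  field_simp

theorem ball_one (d : ℕ) (hd : 1 ≤ d) :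
    volume (Metric.ball (0 : EuclideanSpace ℝ (Fin d)) (r d)) = 1 := by
  rw [Measure.addHaar_ball_of_pos _ _ (r_pos d hd)]
  have : volume (Metric.ball (0 : EuclideanSpace ℝ (Fin d)) 1) = ENNReal.ofReal (V d) := by
    unfold V
    rw [ENNReal.ofReal_toReal measure_ball_lt_top.ne]
  rw [this, ← ENNReal.ofReal_mul (pow_nonneg (r_pos d hd).le _), mul_comm]
  simp [V_mul d hd]

theorem slab_ball_eq (n : ℕ) (R a : ℝ) (h : R ≤ a) :
    {x : EuclideanSpace ℝ (Fin (n+1)) | ‖x‖ < R ∧ |x (Fin.last n)| ≤ a} = Metric.ball 0 R := by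
  ext x
  simp only [Set.mem_ofPred_eq, Metric.mem_ball, dist_zero_right, and_iff_left_iff_imp]
  intro hx
  have := PiLp.norm_apply_le x (Fin.last n)
  rw [Real.norm_eq_abs] at this
  linarith

theorem total (n : ℕ) (hn : 1 ≤ n) :
    V n * ∫ t in (-(r (n+1)))..(r (n+1)), (Real.sqrt (r (n+1)^2 - t^2))^n = 1 := by
  have h1 := slab2 n hn (r (n+1)) (r (n+1)) (r_pos _ (by omega)).le (r_pos _ (by omega)).le
  rw [slab_ball_eq n _ _ le_rfl, ball_one _ (by omega)] at h1
  have := congrArg ENNReal.toReal h1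
  rw [ENNReal.toReal_ofReal_eq_iff.2] at this
  · simpa using this.symm
  · by_contra h
    rw [ENNReal.ofReal_of_nonpos (by linarith)] at h1
    simp at h1

theorem even_int (n : ℕ) (s a : ℝ) :
    ∫ t in (-a)..a, (Real.sqrt (s - t^2))^n = 2 * ∫ t in (0:ℝ)..a, (Real.sqrt (s - t^2))^n := by
  have hc : Continuous fun t : ℝ => (Real.sqrt (s - t^2))^n := by fun_prop
  rw [← intervalIntegral.integral_add_adjacent_intervals (b := 0)
    (hc.intervalIntegrable _ _) (hc.intervalIntegrable _ _)]
  have := intervalIntegral.integral_comp_neg (a := 0) (b := a) (fun t : ℝ => (Real.sqrt (s - t^2))^n)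
  simp only [neg_sq, neg_zero] at this
  rw [← this]; ring

theorem sqrt_pow_eq (w : ℝ) (hw : 0 ≤ w) (n : ℕ) : Real.sqrt w ^ n = w ^ ((n : ℝ) / 2) := by
  rw [Real.sqrt_eq_rpow, ← Real.rpow_natCast, ← Real.rpow_mul hw]
  congr 1; ring

theorem A_bound (n : ℕ) (hn : 2 ≤ n) (s a : ℝ) (ha : 0 < a) (h : a^2 ≤ s) :
    a * Real.sqrt (s - a^2/3) ^ n ≤ ∫ t in (0:ℝ)..a, (Real.sqrt (s - t^2))^n := by
  have hc : Continuous fun t : ℝ => (Real.sqrt (s - t^2))^n := by fun_prop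
  have hb : 0 < a^2 := by positivity
  set c := s - a^2/3 with hcdef
  have hc0 : 0 < c := by linarith
  have key : ∫ t in (0:ℝ)..a, (Real.sqrt c ^ n * (1 + (n:ℝ)/2 / c * (a^2/3 - t^2))) = a * Real.sqrt c ^ n := by
    rw [intervalIntegral.integral_const_mul, intervalIntegral.integral_add (by simp) (Continuous.intervalIntegrable (by fun_prop) _ _),
      intervalIntegral.integral_const_mul, intervalIntegral.integral_sub (by simp) (Continuous.intervalIntegrable (by fun_prop) _ _)]
    simp
    ring
  rw [← key]
  apply intervalIntegral.integral_mono_on ha.le (Continuous.intervalIntegrable (by fun_prop) _ _) (hc.intervalIntegrable _ _)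
  intro t ht
  have ht2 : t^2 ≤ a^2 := by have := ht.1; have := ht.2; gcongr
  have hw : 0 ≤ s - t^2 := by linarith
  have hp : (1:ℝ) ≤ (n:ℝ)/2 := by
    have : (2:ℝ) ≤ n := by exact_mod_cast hn
    linarith
  have e : 1 + (a^2/3 - t^2)/c = (s - t^2)/c := by
    field_simp
    rw [hcdef]; ring
  have hB := one_add_mul_self_le_rpow_one_add (s := (a^2/3 - t^2)/c) (by
    have : 0 ≤ (s - t^2)/c := by positivity
    linarith) hp
  rw [e, Real.div_rpow hw hc0.le, ← sqrt_pow_eq _ hw, ← sqrt_pow_eq _ hc0.le] at hB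
  have hs : 0 < Real.sqrt c ^ n := by positivity
  rw [le_div_iff₀ hs] at hB
  calc _ = (1 + ↑n / 2 * ((a ^ 2 / 3 - t ^ 2) / c)) * √c ^ n := by ring
    _ ≤ _ := hB

theorem T_bound (n : ℕ) (R a : ℝ) (ha : 0 < a) (h : a ≤ R) :
    ∫ t in a..R, (Real.sqrt (R^2 - t^2))^n ≤ Real.sqrt (R^2 - a^2) ^ (n+2) / ((n+2) * a) := by
  have hc : Continuous fun t : ℝ => (Real.sqrt (R^2 - t^2))^n := by fun_prop
  have hc' : Continuous fun t : ℝ => t / a * (Real.sqrt (R^2 - t^2))^n := by fun_prop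
  have e : ∫ t in a..R, t / a * (Real.sqrt (R^2 - t^2))^n = 
     (fun t => -((R^2-t^2) ^ (((n+2:ℕ):ℝ)/2)) / ((n+2) * a)) R - (fun t => -((R^2-t^2) ^ (((n+2:ℕ):ℝ)/2)) / ((n+2) * a)) a := by
    refine intervalIntegral.integral_eq_sub_of_hasDerivAt (f := fun t => -((R^2-t^2) ^ (((n+2:ℕ):ℝ)/2)) / ((n+2) * a)) ?_ (hc'.intervalIntegrable _ _)
    intro t ht
    rw [Set.uIcc_of_le h] at ht
    have ht2 : 0 ≤ R^2 - t^2 := by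
      have := ht.2
      have : 0 ≤ t := by linarith [ht.1]
      nlinarith
    have h1 : HasDerivAt (fun t : ℝ => R^2 - t^2) (-(2*t)) t := by
      simpa using (hasDerivAt_pow 2 t).const_sub (R^2)
    have h2 := ((h1.rpow_const (p := ((n+2:ℕ):ℝ)/2) (Or.inr (by push_cast; linarith [Nat.cast_nonneg (α := ℝ) n]))).neg).div_const (((n:ℝ)+2) * a)
    refine HasDerivAt.congr_deriv h2 ?_
    symm
    rw [sqrt_pow_eq _ ht2]
    have : ((n+2:ℕ):ℝ)/2 - 1 = (n:ℝ)/2 := by push_cast; ring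
    rw [this]
    push_cast
    field_simp
  calc _ ≤ ∫ t in a..R, t / a * (Real.sqrt (R^2 - t^2))^n := by
        apply intervalIntegral.integral_mono_on h (hc.intervalIntegrable _ _) (hc'.intervalIntegrable _ _)
        intro t ht
        apply le_mul_of_one_le_left (by positivity)
        rw [one_le_div ha]; exact ht.1
    _ = _ := by
        rw [e, sqrt_pow_eq _ (by nlinarith)]
        simp only [sub_self]
        rw [Real.zero_rpow (by positivity)]
        ring

theorem main_red (n : ℕ) (hn : 2 ≤ n) (a : ℝ) (ha : 0 < a)
    (hh : a ≤ r (n+1) → 16 * (r (n+1)^2 - a^2)^(n+2) ≤ (a^2)^2 * ((n:ℝ)+2)^2 * (r (n+1)^2 - a^2/3)^n) :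
    ENNReal.ofReal (4/5) ≤ volume {x : EuclideanSpace ℝ (Fin (n+1)) | ‖x‖ < r (n+1) ∧ |x (Fin.last n)| ≤ a} := by
  have hR := r_pos (n+1) (by omega)
  have tot := total n (by omega)
  have hV := V_pos n (by omega)
  set R := r (n+1) with hRdef
  rcases le_total R a with h | h
  · rw [slab_ball_eq n R a h, hRdef, ball_one _ (by omega)]
    simp; norm_num
  rw [slab2 n (by omega) R a hR.le ha.le]
  apply ENNReal.ofReal_le_ofReal
  have hh := hh h
  rw [even_int] at tot ⊢
  have hc : Continuous fun t : ℝ => (Real.sqrt (R^2 - t^2))^n := by fun_prop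
  rw [← intervalIntegral.integral_add_adjacent_intervals (b := a)
    (hc.intervalIntegrable _ _) (hc.intervalIntegrable _ _)] at tot
  have hab : a^2 ≤ R^2 := by gcongr
  have hA := A_bound n hn (R^2) a ha hab
  have hT := T_bound n R a ha h
  set A := ∫ t in (0:ℝ)..a, (Real.sqrt (R^2 - t^2))^n
  set T := ∫ t in a..R, (Real.sqrt (R^2 - t^2))^n
  have hcmp : 4 * Real.sqrt (R^2 - a^2) ^ (n+2) ≤ a^2 * (n+2) * Real.sqrt (R^2 - a^2/3) ^ n := by
    apply le_of_sq_le_sq _ (by positivity)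
    have e1 : (4 * Real.sqrt (R^2 - a^2) ^ (n+2))^2 = 16 * (Real.sqrt (R^2 - a^2)^2) ^ (n+2) := by ring
    have e2 : (a^2 * (n+2) * Real.sqrt (R^2 - a^2/3) ^ n)^2 = (a^2)^2 * ((n:ℝ)+2)^2 * (Real.sqrt (R^2 - a^2/3)^2)^n := by ring
    rw [e1, e2, Real.sq_sqrt (by linarith), Real.sq_sqrt (by nlinarith)]
    exact hh
  have hTA : T ≤ A / 4 := by
    refine hT.trans (le_trans ?_ (div_le_div_of_nonneg_right hA (by norm_num)))
    rw [div_le_div_iff₀ (by positivity) (by norm_num)]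
    nlinarith
  nlinarith

noncomputable def G (d : ℕ) : ℝ := Real.Gamma ((d:ℝ) / 2 + 1) ^ 2

theorem G_succ (d : ℕ) : G (d+2) = ((d:ℝ)/2+1)^2 * G d := by
  unfold G
  have : (((d+2:ℕ):ℝ)/2 + 1) = ((d:ℝ)/2+1) + 1 := by push_cast; ring
  rw [this, Real.Gamma_add_one (by positivity)]
  ring

theorem G_zero : G 0 = 1 := by simp [G]

theorem G_one : G 1 = Real.pi / 4 := by
  unfold G
  have : (((1:ℕ):ℝ)/2 + 1) = 1/2 + 1 := by push_cast; ring
  rw [this, Real.Gamma_add_one (by norm_num), Real.Gamma_one_half_eq, mul_pow, Real.sq_sqrt Real.pi_pos.le]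
  ring

theorem G_two : G 2 = 1 := by rw [G_succ 0, G_zero]; norm_num
theorem G_three : G 3 = 9 / 16 * Real.pi := by rw [G_succ 1, G_one]; push_cast; ring
theorem G_four : G 4 = 4 := by rw [G_succ 2, G_two]; norm_num
theorem G_five : G 5 = 225 / 64 * Real.pi := by rw [G_succ 3, G_three]; push_cast; ring
theorem G_six : G 6 = 36 := by rw [G_succ 4, G_four]; norm_num
theorem G_seven : G 7 = 11025 / 256 * Real.pi := by rw [G_succ 5, G_five]; push_cast; ring
theorem G_eight : G 8 = 576 := by rw [G_succ 6, G_six]; norm_num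
theorem G_nine : G 9 = 893025 / 1024 * Real.pi := by rw [G_succ 7, G_seven]; push_cast; ring

theorem pi_s_pow (d : ℕ) (hd : 1 ≤ d) : (Real.pi * r d ^ 2) ^ d = G d := by
  have h := V_mul d hd
  rw [V_eq d hd] at h
  have : 0 < Real.Gamma (d / 2 + 1) := Real.Gamma_pos_of_pos (by positivity)
  have h2 : √Real.pi ^ d * r d ^ d = Real.Gamma (d / 2 + 1) := by
    rw [div_mul_eq_mul_div, div_eq_one_iff_eq this.ne'] at h
    exact h
  unfold G
  rw [← h2]
  calc _ = (√Real.pi ^ 2 * r d ^ 2) ^ d := by rw [Real.sq_sqrt Real.pi_pos.le]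
    _ = _ := by ring

theorem s_le (d : ℕ) (hd : 1 ≤ d) (K : ℝ) (hK : 0 ≤ K) (h : G d ≤ (Real.pi * K) ^ d) : r d ^ 2 ≤ K := by
  rw [← pi_s_pow d hd] at h
  have := Real.pi_pos
  have h3 := le_of_pow_le_pow_left₀ (by omega) (by positivity) h
  exact le_of_mul_le_mul_left h3 this

theorem second_bern (x : ℝ) (hx : 0 ≤ x) (n : ℕ) : 1 + n * x + n * (n-1) / 2 * x^2 ≤ (1+x)^n := by
  induction n with
  | zero => simp
  | succ k ih =>
    rw [pow_succ]
    have : (1 + k * x + k * (k-1) / 2 * x^2) * (1+x) ≤ (1+x)^k * (1+x) := by gcongr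
    refine le_trans ?_ this
    push_cast
    have hk : (0:ℝ) ≤ k * (k-1) := by
      rcases Nat.eq_zero_or_pos k with h | h
      · simp [h]
      · have : (1:ℝ) ≤ k := by exact_mod_cast h
        nlinarith
    have : 0 ≤ (k:ℝ) * (k-1) * x^3 := by positivity
    nlinarith

theorem G_bound_step (d : ℕ) (hd : 8 ≤ d) (h : G d ≤ (0.2462 * ((d:ℝ)+1))^d) :
    G (d+2) ≤ (0.2462 * (((d+2:ℕ):ℝ)+1))^(d+2) := by
  have hd' : (8:ℝ) ≤ d := by exact_mod_cast hd
  rw [G_succ]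
  have hb := second_bern (2 / ((d:ℝ)+1)) (by positivity) d
  have e : 1 + 2 / ((d:ℝ)+1) = (d+3)/(d+1) := by field_simp; ring
  rw [e, div_pow _ _ d, le_div_iff₀ (by positivity)] at hb
  have h4 : (4.125:ℝ) ≤ 1 + d * (2 / ((d:ℝ)+1)) + d * (d-1)/2 * (2 / ((d:ℝ)+1))^2 := by
    have : 1 + d * (2 / ((d:ℝ)+1)) + d * (d-1)/2 * (2 / ((d:ℝ)+1))^2 = ((d+1)^2 + 2*d*(d+1) + 2*d*(d-1))/(d+1)^2 := by
      field_simp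
    rw [this, le_div_iff₀ (by positivity)]
    nlinarith
  have h5 : 4.125 * ((d:ℝ)+1)^d ≤ (d+3)^d := le_trans (by gcongr) hb
  have h6 : ((d:ℝ)/2+1)^2 * (0.2462 * ((d:ℝ)+1))^d ≤ (0.2462 * (((d+2:ℕ):ℝ)+1))^(d+2) := by
    push_cast
    have : (d:ℝ)+2+1 = d+3 := by ring
    rw [this, mul_pow, mul_pow, pow_add, pow_add]
    have c1 : ((d:ℝ)/2+1)^2 ≤ 4.125 * (0.2462^2 * (d+3)^2) := by nlinarith
    generalize (0.2462:ℝ)^2 = A2 at *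
    have hA : (0:ℝ) ≤ 0.2462^d := by positivity
    have hA2 : 0 ≤ A2 := by
      by_contra hc
      nlinarith [mul_pos (neg_pos.2 (not_le.1 hc)) (show (0:ℝ) < (d+3)^2 by positivity), sq_nonneg ((d:ℝ)/2+1)]
    generalize (0.2462:ℝ)^d = A at *
    calc ((d:ℝ)/2+1)^2 * (A * ((d:ℝ)+1)^d) ≤ (4.125 * (A2 * ((d:ℝ)+3)^2)) * (A * ((d:ℝ)+1)^d) := by gcongr
      _ = A * A2 * ((4.125 * ((d:ℝ)+1)^d) * ((d:ℝ)+3)^2) := by ring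
      _ ≤ A * A2 * (((d:ℝ)+3)^d * ((d:ℝ)+3)^2) := by gcongr
  exact le_trans (by gcongr) h6

theorem G_bound (d : ℕ) (hd : 8 ≤ d) : G d ≤ (0.2462 * ((d:ℝ)+1))^d := by
  induction d using Nat.strong_induction_on with
  | _ d ih =>
    rcases Nat.lt_or_ge d 10 with h | h
    · interval_cases d
      · rw [G_eight]; norm_num
      · rw [G_nine]; have := Real.pi_lt_d2; norm_num at this ⊢; linarith
    · obtain ⟨e, rfl⟩ : ∃ e, d = e + 2 := ⟨d - 2, by omega⟩
      exact G_bound_step e (by omega) (ih e (by omega) (by omega))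

theorem num_red (m : ℕ) (s K b C : ℝ) (hb : 0 < b) (hs : b ≤ s) (hK : s ≤ K)
    (h : 16 * (K - b)^(m+2) ≤ C * (K - b/3)^m) : 16 * (s - b)^(m+2) ≤ C * (s - b/3)^m := by
  have h1 : (s-b) * (K-b/3) ≤ (K-b) * (s-b/3) := by nlinarith
  have p1 : 0 ≤ s - b := by linarith
  have p2 : 0 < K - b/3 := by linarith
  have p3 : 0 < s - b/3 := by linarith
  have p4 : 0 ≤ K - b := by linarith
  have h2 : ((s-b) * (K-b/3))^m ≤ ((K-b) * (s-b/3))^m := by gcongr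
  rw [mul_pow, mul_pow] at h2
  have h3 : (s-b)^2 ≤ (K-b)^2 := by gcongr
  refine le_of_mul_le_mul_right ?_ (pow_pos p2 m)
  calc 16 * (s - b)^(m+2) * (K-b/3)^m = 16 * ((s - b)^2 * ((s-b)^m * (K-b/3)^m)) := by ring
    _ ≤ 16 * ((K - b)^2 * ((K-b)^m * (s-b/3)^m)) := by gcongr
    _ = 16 * (K - b)^(m+2) * (s-b/3)^m := by ring
    _ ≤ C * (K - b/3)^m * (s-b/3)^m := by gcongr
    _ = _ := by ring

theorem exp_num : Real.exp (-1.36) ≤ 0.2603 := by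
  have h := Real.sum_le_exp_of_nonneg (x := 0.34) (by norm_num) 4
  norm_num [Finset.sum_range_succ, Nat.factorial] at h
  have e : Real.exp 1.36 = Real.exp (17/50) ^ 4 := by rw [← Real.exp_nat_mul]; norm_num
  have h2 : (3.85:ℝ) ≤ Real.exp 1.36 := by
    rw [e]
    refine le_trans ?_ (pow_le_pow_left₀ (by norm_num) h 4)
    norm_num
  rw [Real.exp_neg, inv_le_comm₀ (by positivity) (by norm_num)]
  refine le_trans ?_ h2
  norm_num

theorem num_big (n : ℕ) (hn : 7 ≤ n) : 
    16 * (0.0784 * ((n:ℝ)+2) - 0.16)^(n+2) ≤ (0.16)^2 * ((n:ℝ)+2)^2 * (0.0784 * ((n:ℝ)+2) - 0.16/3)^n := by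
  have hn' : (7:ℝ) ≤ n := by exact_mod_cast hn
  set K := 0.0784 * ((n:ℝ)+2) with hKd
  have hK : 0.7 ≤ K := by linarith
  set u := 1 - 2*0.16/(3*K) with hu
  have hKu : K * u = K - 0.32/3 := by rw [hu]; field_simp; norm_num
  have hu0 : 0 < u := by
    by_contra hc
    nlinarith
  have hq : K - 0.16 ≤ u * (K - 0.16/3) := by
    have : u ≤ 1 := by rw [hu]; have : 0 ≤ 2*0.16/(3*K) := by positivity
                       linarith
    nlinarith
  have hexp : u^(n+2) ≤ 0.2603 := by
    have h1 : u ≤ Real.exp (-(2*0.16/(3*K))) := Real.one_sub_le_exp_neg _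
    calc u^(n+2) ≤ (Real.exp (-(2*0.16/(3*K))))^(n+2) := by gcongr
      _ = Real.exp (-(0.32/(3*0.0784))) := by
        rw [← Real.exp_nat_mul]; congr 1; rw [hKd]; push_cast; field_simp; norm_num
      _ ≤ Real.exp (-1.36) := by apply Real.exp_le_exp.2; norm_num
      _ ≤ _ := exp_num
  have p : 0 ≤ K - 0.16 := by linarith
  have p2 : 0 ≤ K - 0.16/3 := by linarith
  calc 16 * (K - 0.16)^(n+2) = 16 * ((K-0.16)^n * (K-0.16)^2) := by ring
    _ ≤ 16 * ((u * (K-0.16/3))^n * (K*u)^2) := by gcongr; linarith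
    _ = 16 * u^(n+2) * K^2 * (K-0.16/3)^n := by rw [mul_pow u]; ring
    _ ≤ 16 * 0.2603 * K^2 * (K-0.16/3)^n := by gcongr
    _ = (16 * 0.2603 * 0.0784^2) * ((n:ℝ)+2)^2 * (K-0.16/3)^n := by rw [hKd]; ring
    _ ≤ _ := by gcongr; norm_num

theorem final_big (n : ℕ) (hn : 2 ≤ n) :
    ENNReal.ofReal (4/5) ≤ volume {x : EuclideanSpace ℝ (Fin (n+1)) | ‖x‖ < r (n+1) ∧ |x (Fin.last n)| ≤ 2/5} := by
  apply main_red n hn (2/5) (by norm_num)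
  intro h
  have hb : ((2:ℝ)/5)^2 = 0.16 := by norm_num
  have hs : (0.16:ℝ) ≤ r (n+1)^2 := by rw [← hb]; gcongr
  rw [hb]
  have pl := Real.pi_gt_d6
  suffices ∃ K : ℝ, 0 ≤ K ∧ G (n+1) ≤ (Real.pi * K)^(n+1) ∧
     16 * (K - 0.16)^(n+2) ≤ (0.16)^2 * ((n:ℝ)+2)^2 * (K - 0.16/3)^n by
    obtain ⟨K, hK, h1, h2⟩ := this
    exact num_red n _ K _ _ (by norm_num) hs (s_le _ (by omega) K hK h1) h2
  rcases Nat.lt_or_ge n 7 with h7 | h7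
  · have odd : ∀ (m : ℕ) (c K : ℝ), 0 ≤ K → c ≤ 3.141592 ^ m * K ^ (m+1) → c * Real.pi ≤ (Real.pi * K)^(m+1) := by
      intro m c K hK hc
      have : c ≤ Real.pi ^ m * K^(m+1) := hc.trans (by gcongr)
      calc c * Real.pi ≤ (Real.pi ^ m * K^(m+1)) * Real.pi := by gcongr
        _ = _ := by ring
    have ev : ∀ (m : ℕ) (c K : ℝ), 0 ≤ K → c ≤ (3.141592 * K) ^ m → c ≤ (Real.pi * K)^m := by
      intro m c K hK hc
      exact hc.trans (by gcongr)
    interval_cases n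
    · refine ⟨0.385, by norm_num, ?_, by norm_num⟩
      rw [G_three]; exact odd 2 _ _ (by norm_num) (by norm_num)
    · refine ⟨0.4503, by norm_num, ?_, by norm_num⟩
      rw [G_four]; exact ev 4 _ _ (by norm_num) (by norm_num)
    · refine ⟨0.515, by norm_num, ?_, by norm_num⟩
      rw [G_five]; exact odd 4 _ _ (by norm_num) (by norm_num)
    · refine ⟨0.579, by norm_num, ?_, by norm_num⟩
      rw [G_six]; exact ev 6 _ _ (by norm_num) (by norm_num)
    · refine ⟨0.642, by norm_num, ?_, by norm_num⟩
      rw [G_seven]; exact odd 6 _ _ (by norm_num) (by norm_num)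
  · refine ⟨0.0784 * ((n:ℝ)+2), by positivity, ?_, num_big n h7⟩
    refine (G_bound (n+1) (by omega)).trans ?_
    push_cast
    have : (n:ℝ)+1+1 = n+2 := by ring
    rw [this, ← mul_assoc]
    gcongr
    linarith

theorem final_one :
    ENNReal.ofReal (4/5) ≤ volume {x : EuclideanSpace ℝ (Fin (0+1)) | ‖x‖ < r (0+1) ∧ |x (Fin.last 0)| ≤ 2/5} := by
  have hs := pi_s_pow 1 le_rfl
  rw [G_one, pow_one] at hs
  have h4 : r 1 ^ 2 = 1/4 := by
    have := Real.pi_pos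
    apply mul_left_cancel₀ this.ne'
    linarith
  rw [slab 0 _ _ (r_pos _ (by omega)).le]
  have : ∫⁻ t in Set.Icc (-(2/5:ℝ)) (2/5), volume (Metric.ball (0 : EuclideanSpace ℝ (Fin 0)) (Real.sqrt (r (0+1)^2 - t^2)))
     = ∫⁻ t in Set.Icc (-(2/5:ℝ)) (2/5), 1 := by
    apply setLIntegral_congr_fun measurableSet_Icc
    intro t ht
    have hp : 0 < Real.sqrt (r (0+1)^2 - t^2) := by
      apply Real.sqrt_pos.2
      have := ht.1
      have := ht.2
      simp only [zero_add, h4]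
      nlinarith
    have hu : Metric.ball (0 : EuclideanSpace ℝ (Fin 0)) (Real.sqrt (r (0+1)^2 - t^2)) = Set.univ := by
      ext y
      simp [Subsingleton.elim y 0, hp]
    simp only [hu]
    have := (PiLp.volume_preserving_ofLp (Fin 0)).measure_preimage MeasurableSet.univ.nullMeasurableSet
    rw [Set.preimage_univ] at this
    rw [this, volume_pi, Measure.pi_of_empty]
    simp
  rw [this]
  simp
  apply ENNReal.ofReal_le_ofReal
  norm_num

theorem final_two :
    ENNReal.ofReal (4/5) ≤ volume {x : EuclideanSpace ℝ (Fin (1+1)) | ‖x‖ < r (1+1) ∧ |x (Fin.last 1)| ≤ 2/5} := by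
  have hs := pi_s_pow 2 (by norm_num)
  have hpi := Real.pi_pos
  rw [G_two] at hs
  have hs1 : Real.pi * r 2 ^ 2 = 1 := by
    have : 0 ≤ Real.pi * r 2 ^ 2 := by positivity
    nlinarith
  have hV : V 1 = 2 := by
    rw [V_eq 1 le_rfl]
    have : (((1:ℕ):ℝ)/2 + 1) = 1/2 + 1 := by push_cast; ring
    rw [this, Real.Gamma_add_one (by norm_num), Real.Gamma_one_half_eq]
    have : 0 < √Real.pi := by positivity
    field_simp
  rw [slab2 1 le_rfl _ _ (r_pos _ (by omega)).le (by norm_num), even_int, hV]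
  apply ENNReal.ofReal_le_ofReal
  have hlow : (0.318:ℝ) ≤ r 2 ^ 2 := by
    have := Real.pi_lt_d4
    by_contra hc
    nlinarith
  have : ∫ t in (0:ℝ)..(2/5), (0.5639 - 0.5639⁻¹/2 * t^2 - 1.04 * t^4) ≤ ∫ t in (0:ℝ)..(2/5), √(r (1+1)^2 - t^2)^1 := by
    apply intervalIntegral.integral_mono_on (by norm_num) (Continuous.intervalIntegrable (by fun_prop) _ _) (Continuous.intervalIntegrable (by fun_prop) _ _)
    intro t ht
    have h0 := ht.1
    have ht2 : t^2 ≤ 0.16 := by have := ht.2; nlinarith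
    rw [pow_one]
    apply Real.le_sqrt_of_sq_le
    have e4 : t^4 = (t^2)^2 := by ring
    rw [e4]
    have : (0:ℝ) ≤ t^2 := by positivity
    generalize t^2 = v at *
    refine le_trans ?_ (sub_le_sub_right hlow v)
    nlinarith [mul_nonneg this this, mul_nonneg (mul_nonneg this this) (sub_nonneg.2 ht2), mul_nonneg (mul_nonneg (mul_nonneg this this) this) (sub_nonneg.2 ht2)]
  have e : ∫ t in (0:ℝ)..(2/5), (0.5639 - 0.5639⁻¹/2 * t^2 - 1.04 * t^4) = 0.5639 * (2/5) - 0.5639⁻¹/2 * ((2/5)^3/3) - 1.04 * ((2/5)^5/5) := by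
    rw [intervalIntegral.integral_sub (Continuous.intervalIntegrable (by fun_prop) _ _) (Continuous.intervalIntegrable (by fun_prop) _ _),
     intervalIntegral.integral_sub (Continuous.intervalIntegrable (by fun_prop) _ _) (Continuous.intervalIntegrable (by fun_prop) _ _),
     intervalIntegral.integral_const_mul, intervalIntegral.integral_const_mul]
    simp only [integral_pow, intervalIntegral.integral_const]
    norm_num
  rw [e] at this
  refine le_trans ?_ (mul_le_mul_of_nonneg_left (mul_le_mul_of_nonneg_left this (by norm_num)) (by norm_num))
  norm_num

/-- The slice of the ball of unit volume in `ℝ^d` by the slab `|x_d| ≤ 0.4` (a tube of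
radius `0.4` around a hyperplane through the centre) has volume at least `0.8`, in every
dimension `d ≥ 1`. -/
theorem slab_slice_of_unit_volume_ball (d : ℕ) (hd : 0 < d) :
    ENNReal.ofReal (4 / 5) ≤
      volume {x : EuclideanSpace ℝ (Fin d) |
        ‖x‖ < r d ∧ |x ⟨d - 1, by omega⟩| ≤ 2 / 5} := by
  obtain ⟨n, rfl⟩ : ∃ n, d = n + 1 := ⟨d - 1, by omega⟩
  change ENNReal.ofReal (4/5) ≤ volume {x : EuclideanSpace ℝ (Fin (n+1)) | ‖x‖ < r (n+1) ∧ |x (Fin.last n)| ≤ 2/5}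
  rcases Nat.lt_or_ge n 2 with h | h
  · interval_cases n
    · exact final_one
    · exact final_two
  · exact final_big n h
end

section
/- In the exterior algebra Λ(ℝ^8) with standard basis e_1,…,e_8, writing e^{i_1…i_k} for e_{i_1}∧⋯∧e_{i_k}, let ω_1 = e^{13}+e^{57}+e^{24}+e^{68}, ω_2 = e^{15}−e^{37}+e^{26}−e^{48}, ω_3 = e^{17}+e^{35}+e^{28}+e^{46}, and let τ = e^{12}+e^{34}+e^{56}, α = 3e^{135}+e^{146}+e^{236}+e^{245}, β = 3e^{246}+e^{235}+e^{136}+e^{145}. Then the 4-form Ω_+ = ω_1∧ω_1 + ω_2∧ω_2 + ω_3∧ω_3 satisfies Ω_+ = −τ∧τ + 2 α∧e^7 + 2 β∧e^8 − 2 τ∧e^7∧e^8. -/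
open ExteriorAlgebra

/-- `e i` is the image in the exterior algebra `Λ(ℝ^8)` of the `(i+1)`-st standard basis
vector of `ℝ^8`; thus `e 0, …, e 7` represent `e_1, …, e_8`. -/
noncomputable def e (i : Fin 8) : ExteriorAlgebra ℝ (Fin 8 → ℝ) :=
  ExteriorAlgebra.ι ℝ (Pi.single i 1)

theorem e_sq (i : Fin 8) : e i * e i = 0 := ExteriorAlgebra.ι_sq_zero _

theorem e_sq_assoc (i : Fin 8) (x : ExteriorAlgebra ℝ (Fin 8 → ℝ)) : e i * (e i * x) = 0 := by
  rw [← mul_assoc, e_sq, zero_mul]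

theorem e_anti (i j : Fin 8) : e i * e j = -(e j * e i) :=
  eq_neg_of_add_eq_zero_left (ExteriorAlgebra.ι_add_mul_swap _ _)

/-- Sorting step for two generators in the wrong order. -/
theorem e_swap (i j : Fin 8) (_h : j < i) : e i * e j = -(e j * e i) := e_anti i j

/-- Sorting step for two generators in the wrong order, in front of another factor. -/
theorem e_swap_assoc (i j : Fin 8) (_h : j < i) (x : ExteriorAlgebra ℝ (Fin 8 → ℝ)) :
    e i * (e j * x) = -(e j * (e i * x)) := by
  rw [← mul_assoc, e_anti i j, neg_mul, mul_assoc]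

theorem three_mul_expand (x : ExteriorAlgebra ℝ (Fin 8 → ℝ)) : 3 * x = x + x + x := by
  rw [← two_add_one_eq_three, add_mul, two_mul, one_mul]

/-- With `ω₁ = e¹³+e⁵⁷+e²⁴+e⁶⁸`, `ω₂ = e¹⁵−e³⁷+e²⁶−e⁴⁸`, `ω₃ = e¹⁷+e³⁵+e²⁸+e⁴⁶`,
`τ = e¹²+e³⁴+e⁵⁶`, `α = 3e¹³⁵+e¹⁴⁶+e²³⁶+e²⁴⁵`, `β = 3e²⁴⁶+e²³⁵+e¹³⁶+e¹⁴⁵`,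
the 4-form `Ω₊ = ω₁∧ω₁+ω₂∧ω₂+ω₃∧ω₃` equals `−τ∧τ + 2α∧e⁷ + 2β∧e⁸ − 2τ∧e⁷∧e⁸`. -/
theorem sp2sp1_form_dimensional_reduction :
    let ω₁ := e 0 * e 2 + e 4 * e 6 + e 1 * e 3 + e 5 * e 7
    let ω₂ := e 0 * e 4 - e 2 * e 6 + e 1 * e 5 - e 3 * e 7
    let ω₃ := e 0 * e 6 + e 2 * e 4 + e 1 * e 7 + e 3 * e 5
    let τ := e 0 * e 1 + e 2 * e 3 + e 4 * e 5
    let α := 3 * (e 0 * e 2 * e 4) + e 0 * e 3 * e 5 + e 1 * e 2 * e 5 + e 1 * e 3 * e 4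
    let β := 3 * (e 1 * e 3 * e 5) + e 1 * e 2 * e 4 + e 0 * e 2 * e 5 + e 0 * e 3 * e 4
    ω₁ * ω₁ + ω₂ * ω₂ + ω₃ * ω₃ =
      -(τ * τ) + 2 * (α * e 6) + 2 * (β * e 7) - 2 * (τ * e 6 * e 7) := by
  intro ω₁ ω₂ ω₃ τ α β
  simp only [ω₁, ω₂, ω₃, τ, α, β]
  simp only [two_mul, three_mul_expand, mul_add, add_mul, mul_sub, sub_mul, mul_assoc]
  simp (discharger := decide) only [e_sq, e_sq_assoc, e_swap, e_swap_assoc, mul_neg, neg_mul,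
    mul_zero, zero_mul, neg_neg, neg_zero]
  abel
end

section
/- There are exactly 3 isomorphism classes of real 4-dimensional nilpotent Lie algebras, represented by the abelian Lie algebra ℝ^4 (1-step), the direct sum of the 3-dimensional Heisenberg algebra with ℝ (2-step), and the filiform algebra with basis e_1, e_2, e_3, e_4 and nonzero brackets [e_1, e_2] = e_3, [e_1, e_3] = e_4 (3-step). -/
/-- A Lie algebra structure on `ℝ^n`: a bilinear, alternating bracket satisfying the
Jacobi identity. -/
structure LieStruct (n : ℕ) where
  bracket : (Fin n → ℝ) → (Fin n → ℝ) → (Fin n → ℝ)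
  add_left : ∀ x y z, bracket (x + y) z = bracket x z + bracket y z
  add_right : ∀ x y z, bracket x (y + z) = bracket x y + bracket x z
  smul_left : ∀ (c : ℝ) x y, bracket (c • x) y = c • bracket x y
  smul_right : ∀ (c : ℝ) x y, bracket x (c • y) = c • bracket x y
  alt : ∀ x, bracket x x = 0
  jacobi : ∀ x y z,
    bracket x (bracket y z) + bracket y (bracket z x) + bracket z (bracket x y) = 0

/-- The lower central series of a Lie algebra structure: `C⁰ = g`,
`Cᵏ⁺¹ = [g, Cᵏ]`. -/
def lcs {n : ℕ} (L : LieStruct n) : ℕ → Submodule ℝ (Fin n → ℝ)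
  | 0 => ⊤
  | k + 1 => Submodule.span ℝ {z | ∃ x y, y ∈ lcs L k ∧ z = L.bracket x y}

/-- A Lie algebra is nilpotent if its lower central series terminates at zero. -/
def LieStruct.IsNilpotent {n : ℕ} (L : LieStruct n) : Prop := ∃ k, lcs L k = ⊥

/-- Two Lie algebra structures are isomorphic if some linear bijection intertwines the
brackets. -/
def LieStruct.Iso {n : ℕ} (L L' : LieStruct n) : Prop :=
  ∃ f : (Fin n → ℝ) ≃ₗ[ℝ] (Fin n → ℝ), ∀ x y, f (L.bracket x y) = L'.bracket (f x) (f y)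

/-- A complex structure on a Lie algebra: a linear `J` with `J² = −id` and vanishing
Nijenhuis tensor. -/
def LieStruct.AdmitsComplex {n : ℕ} (L : LieStruct n) : Prop :=
  ∃ J : (Fin n → ℝ) →ₗ[ℝ] (Fin n → ℝ),
    (∀ x, J (J x) = -x) ∧
    (∀ x y, L.bracket (J x) (J y) - L.bracket x y
      - J (L.bracket (J x) y) - J (L.bracket x (J y)) = 0)

/-- A symplectic structure on a Lie algebra: a nondegenerate alternating bilinear form
satisfying the closedness (2-cocycle) condition. -/
def LieStruct.AdmitsSymplectic {n : ℕ} (L : LieStruct n) : Prop :=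
  ∃ ω : (Fin n → ℝ) →ₗ[ℝ] (Fin n → ℝ) →ₗ[ℝ] ℝ,
    (∀ x, ω x x = 0) ∧
    (∀ x, (∀ y, ω x y = 0) → x = 0) ∧
    (∀ x y z, ω (L.bracket x y) z + ω (L.bracket y z) x + ω (L.bracket z x) y = 0)

/-- Isomorphism of Lie algebra structures, restricted to those satisfying `P`. -/
def IsoOn {n : ℕ} (P : LieStruct n → Prop) :
    {L : LieStruct n // P L} → {L : LieStruct n // P L} → Prop :=
  fun L L' => L.1.Iso L'.1
/-- The abelian Lie algebra `ℝ⁴` (1-step nilpotent). -/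
def abelian4 : LieStruct 4 where
  bracket _ _ := 0
  add_left _ _ _ := by simp
  add_right _ _ _ := by simp
  smul_left _ _ _ := by simp
  smul_right _ _ _ := by simp
  alt _ := rfl
  jacobi _ _ _ := by simp

/-- The direct sum of the 3-dimensional Heisenberg algebra with `ℝ` (2-step nilpotent):
the only nonzero bracket of basis vectors is `[e₁, e₂] = e₃`. -/
def heis4 : LieStruct 4 where
  bracket x y := ![0, 0, x 0 * y 1 - x 1 * y 0, 0]
  add_left x y z := by funext i; fin_cases i <;> simp <;> ring
  add_right x y z := by funext i; fin_cases i <;> simp <;> ring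
  smul_left c x y := by funext i; fin_cases i <;> simp <;> ring
  smul_right c x y := by funext i; fin_cases i <;> simp <;> ring
  alt x := by funext i; fin_cases i <;> simp <;> ring
  jacobi x y z := by funext i; fin_cases i <;> simp <;> ring

/-- The filiform Lie algebra (3-step nilpotent): the nonzero brackets of basis vectors
are `[e₁, e₂] = e₃` and `[e₁, e₃] = e₄`. -/
def filiform4 : LieStruct 4 where
  bracket x y := ![0, 0, x 0 * y 1 - x 1 * y 0, x 0 * y 2 - x 2 * y 0]
  add_left x y z := by funext i; fin_cases i <;> simp <;> ring
  add_right x y z := by funext i; fin_cases i <;> simp <;> ring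
  smul_left c x y := by funext i; fin_cases i <;> simp <;> ring
  smul_right c x y := by funext i; fin_cases i <;> simp <;> ring
  alt x := by funext i; fin_cases i <;> simp <;> ring
  jacobi x y z := by funext i; fin_cases i <;> simp <;> ring


namespace LieStruct

/-- The bracket as a bilinear map. -/
def toBilin {n : ℕ} (L : LieStruct n) :
    (Fin n → ℝ) →ₗ[ℝ] (Fin n → ℝ) →ₗ[ℝ] (Fin n → ℝ) :=
  LinearMap.mk₂ ℝ L.bracket L.add_left L.smul_left L.add_right L.smul_right

theorem toBilin_apply {n : ℕ} (L : LieStruct n) (x y) : L.toBilin x y = L.bracket x y := rfl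

theorem zero_right {n : ℕ} (L : LieStruct n) (x) : L.bracket x 0 = 0 := (L.toBilin x).map_zero

theorem zero_left {n : ℕ} (L : LieStruct n) (x) : L.bracket 0 x = 0 := by
  rw [← toBilin_apply]; simp

theorem neg_right {n : ℕ} (L : LieStruct n) (x y) : L.bracket x (-y) = - L.bracket x y :=
  (L.toBilin x).map_neg y

theorem neg_left {n : ℕ} (L : LieStruct n) (x y) : L.bracket (-x) y = - L.bracket x y := by
  simp only [← toBilin_apply]; simp

theorem sub_right {n : ℕ} (L : LieStruct n) (x y z) :
    L.bracket x (y - z) = L.bracket x y - L.bracket x z :=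
  (L.toBilin x).map_sub y z

theorem sub_left {n : ℕ} (L : LieStruct n) (x y z) :
    L.bracket (x - y) z = L.bracket x z - L.bracket y z := by
  simp only [← toBilin_apply]; simp

theorem skew {n : ℕ} (L : LieStruct n) (x y) : L.bracket y x = - L.bracket x y := by
  have h := L.alt (x + y)
  rw [L.add_left, L.add_right, L.add_right, L.alt, L.alt] at h
  simp only [zero_add, add_zero] at h
  exact eq_neg_of_add_eq_zero_right h

theorem leibniz {n : ℕ} (L : LieStruct n) (x y z) :
    L.bracket x (L.bracket y z) = L.bracket (L.bracket x y) z + L.bracket y (L.bracket x z) := by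
  have h := L.jacobi x y z
  rw [L.skew x z, L.neg_right, L.skew (L.bracket x y) z] at h
  linear_combination (exp := 1) h

theorem Iso.refl {n : ℕ} (L : LieStruct n) : L.Iso L := ⟨LinearEquiv.refl ℝ _, fun _ _ => rfl⟩

theorem Iso.symm {n : ℕ} {L M : LieStruct n} (h : L.Iso M) : M.Iso L := by
  obtain ⟨f, hf⟩ := h
  refine ⟨f.symm, fun x y => ?_⟩
  apply f.injective
  simp [hf]

theorem Iso.trans {n : ℕ} {L M N : LieStruct n} (h : L.Iso M) (h' : M.Iso N) : L.Iso N := by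
  obtain ⟨f, hf⟩ := h
  obtain ⟨g, hg⟩ := h'
  exact ⟨f.trans g, fun x y => by simp [hf, hg]⟩

/-- A subspace contained in its own bracket with the algebra is zero. -/
theorem IsNilpotent.eq_bot {n : ℕ} {L : LieStruct n} (h : L.IsNilpotent)
    (W : Submodule ℝ (Fin n → ℝ))
    (hW : W ≤ Submodule.span ℝ {z | ∃ x y, y ∈ W ∧ z = L.bracket x y}) : W = ⊥ := by
  obtain ⟨k, hk⟩ := h
  have key : ∀ k, W ≤ lcs L k := by
    intro k
    induction k with
    | zero => exact le_top
    | succ k ih =>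
      refine hW.trans (Submodule.span_mono ?_)
      rintro z ⟨x, y, hy, rfl⟩
      exact ⟨x, y, ih hy, rfl⟩
  exact le_bot_iff.mp (hk ▸ key k)

/-- An eigenvector of an adjoint map has eigenvalue zero. -/
theorem IsNilpotent.eig {n : ℕ} {L : LieStruct n} (h : L.IsNilpotent)
    {x y : Fin n → ℝ} {c : ℝ} (hxy : L.bracket x y = c • y) (hy : y ≠ 0) : c = 0 := by
  by_contra hc
  have := h.eq_bot (Submodule.span ℝ {y}) (by
    rw [Submodule.span_le]
    rintro z rfl
    refine Submodule.subset_span ⟨c⁻¹ • x, z, Submodule.mem_span_singleton_self z, ?_⟩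
    rw [L.smul_left, hxy, smul_smul, inv_mul_cancel₀ hc, one_smul])
  exact hy (Submodule.span_singleton_eq_bot.mp this)

theorem IsNilpotent.ad_pow_four {L : LieStruct 4} (h : L.IsNilpotent) (x y : Fin 4 → ℝ) :
    L.bracket x (L.bracket x (L.bracket x (L.bracket x y))) = 0 := by
  obtain ⟨k, hk⟩ := h
  have key : ∀ k v, (L.toBilin x ^ k) v ∈ lcs L k := by
    intro k
    induction k with
    | zero => intro v; exact trivial
    | succ k ih =>
      intro v
      rw [pow_succ']
      exact Submodule.subset_span ⟨x, _, ih v, rfl⟩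
  have hnil : L.toBilin x ^ (k + 4) = 0 := by
    refine LinearMap.ext fun v => ?_
    have hv := key k ((L.toBilin x ^ 4) v)
    rw [hk, Submodule.mem_bot] at hv
    rw [pow_add]
    exact hv
  have hker := Module.End.ker_pow_eq_ker_pow_finrank_of_le (f := L.toBilin x) (m := k + 4) (by simp)
  have hy : y ∈ LinearMap.ker (L.toBilin x ^ (k + 4)) := by rw [hnil]; simp
  rw [hker] at hy
  simpa [pow_succ, toBilin_apply] using hy

/-- Two structures with the same structure constants are isomorphic. -/
theorem iso_of_basis {L M : LieStruct 4} (e : Fin 4 → (Fin 4 → ℝ)) (he : LinearIndependent ℝ e)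
    (h : ∀ i j, i < j → L.bracket (e i) (e j) =
      ∑ k, (M.bracket (Pi.single i 1) (Pi.single j 1)) k • e k) : L.Iso M := by
  have h' : ∀ i j, L.bracket (e i) (e j) =
      ∑ k, (M.bracket (Pi.single i 1) (Pi.single j 1)) k • e k := by
    intro i j
    rcases lt_trichotomy i j with hij | rfl | hij
    · exact h i j hij
    · simp [L.alt, M.alt]
    · rw [L.skew, h j i hij, M.skew (Pi.single j 1)]
      simp
  let b := basisOfLinearIndependentOfCardEqFinrank he (by simp)
  have hb : ∀ i, b i = e i := fun i => by simp [b]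
  have hbs : ∀ i, b.equivFun (b i) = Pi.single i 1 := by
    intro i
    ext j
    simp [Finsupp.single_apply, Pi.single_apply, eq_comm]
  refine ⟨b.equivFun, ?_⟩
  have : L.toBilin.compr₂ b.equivFun.toLinearMap =
      M.toBilin.compl₁₂ b.equivFun.toLinearMap b.equivFun.toLinearMap := by
    refine b.ext fun i => b.ext fun j => ?_
    change b.equivFun (L.bracket (b i) (b j)) = M.bracket (b.equivFun (b i)) (b.equivFun (b j))
    rw [hbs, hbs, hb, hb, h']
    have hs := b.equivFun_symm_apply (M.bracket (Pi.single i 1) (Pi.single j 1))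
    simp only [hb] at hs
    rw [← hs, LinearEquiv.apply_symm_apply]
  intro x y
  exact LinearMap.congr_fun₂ this x y

end LieStruct

theorem heis_of_basis {L : LieStruct 4} (a b c d : Fin 4 → ℝ)
    (he : LinearIndependent ℝ ![a, b, c, d])
    (h01 : L.bracket a b = c) (h02 : L.bracket a c = 0) (h03 : L.bracket a d = 0)
    (h12 : L.bracket b c = 0) (h13 : L.bracket b d = 0) (h23 : L.bracket c d = 0) :
    L.Iso heis4 := by
  refine LieStruct.iso_of_basis _ he fun i j hij => ?_
  fin_cases i <;> fin_cases j <;> simp at hij <;>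
    simp [Fin.sum_univ_four, heis4, Pi.single_apply, *]

theorem filiform_of_basis {L : LieStruct 4} (a b c d : Fin 4 → ℝ)
    (he : LinearIndependent ℝ ![a, b, c, d])
    (h01 : L.bracket a b = c) (h02 : L.bracket a c = d) (h03 : L.bracket a d = 0)
    (h12 : L.bracket b c = 0) (h13 : L.bracket b d = 0) (h23 : L.bracket c d = 0) :
    L.Iso filiform4 := by
  refine LieStruct.iso_of_basis _ he fun i j hij => ?_
  fin_cases i <;> fin_cases j <;> simp at hij <;>
    simp [Fin.sum_univ_four, filiform4, Pi.single_apply, *]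

theorem li4 {a b c d : Fin 4 → ℝ}
    (h : ∀ p q r s : ℝ, p • a + q • b + r • c + s • d = 0 → p = 0 ∧ q = 0 ∧ r = 0 ∧ s = 0) :
    LinearIndependent ℝ ![a, b, c, d] := by
  rw [Fintype.linearIndependent_iff]
  intro g hg i
  simp [Fin.sum_univ_four] at hg
  obtain ⟨h0, h1, h2, h3⟩ := h _ _ _ _ hg
  fin_cases i <;> assumption

theorem li4_iff {a b c d : Fin 4 → ℝ} (h : LinearIndependent ℝ ![a, b, c, d])
    (p q r s : ℝ) (hp : p • a + q • b + r • c + s • d = 0) : p = 0 ∧ q = 0 ∧ r = 0 ∧ s = 0 := by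
  rw [Fintype.linearIndependent_iff] at h
  have := h ![p, q, r, s] (by simpa [Fin.sum_univ_four] using hp)
  exact ⟨this 0, this 1, this 2, this 3⟩

theorem exists_coords {a b c d : Fin 4 → ℝ} (h : LinearIndependent ℝ ![a, b, c, d])
    (v : Fin 4 → ℝ) : ∃ p q r s : ℝ, v = p • a + q • b + r • c + s • d := by
  let B := basisOfLinearIndependentOfCardEqFinrank h (by simp)
  have := B.sum_equivFun v
  simp [Fin.sum_univ_four, B] at this
  exact ⟨_, _, _, _, this.symm⟩

theorem filiform_case {L : LieStruct 4} (hL : L.IsNilpotent) (x y : Fin 4 → ℝ)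
    (hxy : L.bracket x (L.bracket x y) ≠ 0) : L.Iso filiform4 := by
  obtain ⟨u, hu⟩ : ∃ u, L.bracket x y = u := ⟨_, rfl⟩
  obtain ⟨w, hw⟩ : ∃ w, L.bracket x u = w := ⟨_, rfl⟩
  rw [hu, hw] at hxy
  have hx : x ≠ 0 := by
    rintro rfl
    exact hxy (by rw [← hw, L.zero_left])
  have hxx := L.alt x
  -- `x` is not in the image of `ad x`
  have himg : ∀ (v : Fin 4 → ℝ) (p : ℝ), L.bracket x v = p • x → p = 0 := by
    intro v p hv
    have := hL.eig (x := v) (y := x) (c := -p) (by rw [L.skew x v, hv, neg_smul]) hx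
    linarith
  have hxw : L.bracket x w = 0 := by
    by_contra hne
    obtain ⟨t, ht⟩ : ∃ t, L.bracket x w = t := ⟨_, rfl⟩
    rw [ht] at hne
    have hxt : L.bracket x t = 0 := by
      have h4 := hL.ad_pow_four x y
      rwa [hu, hw, ht] at h4
    have hli : LinearIndependent ℝ ![y, u, w, t] := by
      apply li4
      intro p q r s h
      have h1 := congrArg (L.bracket x) h
      simp only [L.add_right, L.smul_right, L.zero_right, hu, hw, ht, hxt, smul_zero, add_zero] at h1
      have h2 := congrArg (L.bracket x) h1
      simp only [L.add_right, L.smul_right, L.zero_right, hu, hw, ht, hxt, smul_zero, add_zero] at h2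
      have h3 := congrArg (L.bracket x) h2
      simp only [L.add_right, L.smul_right, L.zero_right, hu, hw, ht, hxt, smul_zero, add_zero] at h3
      have hp : p = 0 := by simpa [hne] using h3
      subst hp
      have hq : q = 0 := by simpa [hne] using h2
      subst hq
      have hr : r = 0 := by simpa [hne] using h1
      subst hr
      have hs : s = 0 := by simpa [hne] using h
      exact ⟨rfl, rfl, rfl, hs⟩
    obtain ⟨p, q, r, s, h⟩ := exists_coords hli x
    have h1 := congrArg (L.bracket x) h
    simp only [L.add_right, L.smul_right, hxx, hu, hw, ht, hxt, smul_zero, add_zero] at h1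
    obtain ⟨-, rfl, rfl, rfl⟩ := li4_iff hli 0 p q r (by rw [zero_smul, zero_add]; exact h1.symm)
    have := himg (s • w) 1 (by rw [L.smul_right, ht, one_smul]; simpa using h.symm)
    norm_num at this
  have hli : LinearIndependent ℝ ![x, y, u, w] := by
    apply li4
    intro p q r s h
    have h1 := congrArg (L.bracket x) h
    simp only [L.add_right, L.smul_right, L.zero_right, hxx, hu, hw, hxw, smul_zero, add_zero,
      zero_add] at h1
    have h2 := congrArg (L.bracket x) h1
    simp only [L.add_right, L.smul_right, L.zero_right, hxx, hu, hw, hxw, smul_zero, add_zero,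
      zero_add] at h2
    have hq : q = 0 := by simpa [hxy] using h2
    subst hq
    have hr : r = 0 := by simpa [hxy] using h1
    subst hr
    have hp : p = 0 := by
      apply himg (-(s • u)) p
      rw [L.neg_right, L.smul_right, hw]
      simp only [zero_smul, add_zero] at h
      exact (eq_neg_of_add_eq_zero_left h).symm
    subst hp
    have hs : s = 0 := by simpa [hxy] using h
    exact ⟨rfl, rfl, rfl, hs⟩
  obtain ⟨a, b, c, d, hv⟩ := exists_coords hli (L.bracket y u)
  have hyw : L.bracket y w = b • u + c • w := by
    have h := L.leibniz x y u
    rw [hu, hw, L.alt, hv, zero_add] at h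
    rw [← h]
    simp only [L.add_right, L.smul_right, hxx, hu, hw, hxw, smul_zero, add_zero, zero_add]
  have huw : L.bracket u w = b • w := by
    have h := L.leibniz x y w
    rw [hu, hxw, L.zero_right, add_zero, hyw] at h
    rw [← h]
    simp only [L.add_right, L.smul_right, hw, hxw, smul_zero, add_zero]
  have hb : b = 0 := hL.eig huw hxy
  subst hb
  have hc : c = 0 := hL.eig (by simpa using hyw) hxy
  subst hc
  simp only [zero_smul, add_zero] at hv hyw huw
  have ha : a = 0 := by
    by_contra ha
    have := hL.eq_bot (Submodule.span ℝ {x, u, w}) (by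
      have mx : x ∈ Submodule.span ℝ {x, u, w} := Submodule.subset_span (by simp)
      have mu : u ∈ Submodule.span ℝ {x, u, w} := Submodule.subset_span (by simp)
      have kw : w ∈ Submodule.span ℝ
          {z | ∃ x' y', y' ∈ Submodule.span ℝ {x, u, w} ∧ z = L.bracket x' y'} :=
        Submodule.subset_span ⟨x, u, mu, hw.symm⟩
      have ku : u ∈ Submodule.span ℝ
          {z | ∃ x' y', y' ∈ Submodule.span ℝ {x, u, w} ∧ z = L.bracket x' y'} :=
        Submodule.subset_span ⟨-y, x, mx, by rw [L.neg_left, L.skew x y, hu, neg_neg]⟩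
      have kx : x ∈ Submodule.span ℝ
          {z | ∃ x' y', y' ∈ Submodule.span ℝ {x, u, w} ∧ z = L.bracket x' y'} := by
        have k : L.bracket y u ∈ Submodule.span ℝ
          {z | ∃ x' y', y' ∈ Submodule.span ℝ {x, u, w} ∧ z = L.bracket x' y'} :=
          Submodule.subset_span ⟨y, u, mu, rfl⟩
        have e : x = a⁻¹ • (L.bracket y u - d • w) := by
          rw [hv, add_sub_cancel_right, smul_smul, inv_mul_cancel₀ ha, one_smul]
        have k' := Submodule.smul_mem _ a⁻¹ (Submodule.sub_mem _ k (Submodule.smul_mem _ d kw))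
        rwa [← e] at k'
      rw [Submodule.span_le]
      rintro z (rfl | rfl | rfl)
      · exact kx
      · exact ku
      · exact kw)
    have hx0 : x ∈ (⊥ : Submodule ℝ (Fin 4 → ℝ)) := this ▸ Submodule.subset_span (by simp)
    exact hx (by simpa using hx0)
  subst ha
  simp only [zero_smul, zero_add] at hv
  refine filiform_of_basis x (y - d • x) u w ?_ ?_ hw hxw ?_ ?_ huw
  · apply li4
    intro p q r s h
    obtain ⟨h0, rfl, rfl, rfl⟩ := li4_iff hli (p - q * d) q r s (by rw [← h]; module)
    exact ⟨by linarith, rfl, rfl, rfl⟩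
  · rw [L.sub_right, L.smul_right, hxx, hu]; simp
  · rw [L.sub_left, L.smul_left, hv, hw, sub_self]
  · rw [L.sub_left, L.smul_left, hyw, hxw]; simp

theorem heis_case {L : LieStruct 4} (h2 : ∀ x y, L.bracket x (L.bracket x y) = 0)
    (x y : Fin 4 → ℝ) (hxy : L.bracket x y ≠ 0) : L.Iso heis4 := by
  have hcen : ∀ x y z, L.bracket x (L.bracket y z) = 0 := by
    have hsw : ∀ x y z, L.bracket x (L.bracket y z) = - L.bracket y (L.bracket x z) := by
      intro x y z
      have h := h2 (x + y) z
      simp only [L.add_left, L.add_right, h2, zero_add, add_zero] at h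
      rw [add_comm] at h
      exact eq_neg_of_add_eq_zero_right (by simpa [add_comm] using h)
    intro x y z
    have h := L.jacobi x y z
    have e1 : L.bracket y (L.bracket z x) = L.bracket x (L.bracket y z) := by
      rw [L.skew x z, L.neg_right, ← hsw]
    have e2 : L.bracket z (L.bracket x y) = L.bracket x (L.bracket y z) := by
      rw [hsw, L.skew y z, L.neg_right, neg_neg]
    rw [e1, e2] at h
    have h3 : (3 : ℝ) • L.bracket x (L.bracket y z) = 0 := by rw [← h]; module
    simpa using h3
  obtain ⟨z, hz⟩ : ∃ z, L.bracket x y = z := ⟨_, rfl⟩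
  rw [hz] at hxy
  have zc : ∀ v, L.bracket v z = 0 := fun v => hz ▸ hcen v x y
  have hyx : L.bracket y x = -z := by rw [L.skew x y, hz]
  have hxx := L.alt x
  have hyy := L.alt y
  obtain ⟨w, hw⟩ : ∃ w, w ∉ Submodule.span ℝ {x, y, z} := by
    by_contra hcon
    push Not at hcon
    have htop : Submodule.span ℝ ({x, y, z} : Set (Fin 4 → ℝ)) = ⊤ :=
      Submodule.eq_top_iff'.mpr hcon
    have hle := finrank_span_finset_le_card (R := ℝ) ({x, y, z} : Finset (Fin 4 → ℝ))
    have hcard := Finset.card_le_three (a := x) (b := y) (c := z)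
    simp only [Finset.coe_insert, Finset.coe_singleton] at hle
    rw [Set.finrank, htop, finrank_top] at hle
    simp at hle
    omega
  have hli : LinearIndependent ℝ ![x, y, z, w] := by
    apply li4
    intro p q r s h
    have hs : s = 0 := by
      by_contra hs
      apply hw
      have e : w = (-(s⁻¹ * p)) • x + (-(s⁻¹ * q)) • y + (-(s⁻¹ * r)) • z := by
        have e1 : s⁻¹ • (s • w) = s⁻¹ • (-(p • x + q • y + r • z)) :=
          congrArg _ (eq_neg_of_add_eq_zero_right h)
        rw [smul_smul, inv_mul_cancel₀ hs, one_smul] at e1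
        rw [e1]; module
      rw [e]
      refine Submodule.add_mem _ (Submodule.add_mem _ ?_ ?_) ?_ <;>
        exact Submodule.smul_mem _ _ (Submodule.subset_span (by simp))
    subst hs
    have k1 := congrArg (L.bracket x) h
    have k2 := congrArg (L.bracket y) h
    simp only [L.add_right, L.smul_right, L.zero_right, hxx, hyy, hz, hyx, zc, smul_zero, add_zero,
      zero_add, zero_smul] at k1 k2
    have hq : q = 0 := by simpa [hxy] using k1
    have hp : p = 0 := by simpa [hxy] using k2
    subst hq hp
    have hr : r = 0 := by simpa [hxy] using h
    exact ⟨rfl, rfl, hr, rfl⟩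
  obtain ⟨c, hc⟩ : ∃ c : ℝ, L.bracket x w = c • z := by
    obtain ⟨p, q, r, s, hg⟩ := exists_coords hli (L.bracket x w)
    have k1 := hcen x x w
    have k2 := hcen y x w
    rw [hg] at k1 k2
    simp only [L.add_right, L.smul_right, hxx, hyy, hz, hyx, zc, smul_zero, add_zero,
      zero_add] at k1 k2
    rw [hg] at k1
    obtain ⟨-, h1, h2, h3⟩ := li4_iff hli (s * p) (s * q) (q + s * r) (s * s)
      (by rw [← k1]; module)
    have hs : s = 0 := by simpa using h3
    subst hs
    have hq : q = 0 := by simpa using h2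
    have hp : p = 0 := by simpa [hxy] using k2
    exact ⟨r, by rw [hg, hq, hp]; simp⟩
  obtain ⟨c', hc'⟩ : ∃ c : ℝ, L.bracket y w = c • z := by
    obtain ⟨p, q, r, s, hg⟩ := exists_coords hli (L.bracket y w)
    have k1 := hcen y y w
    have k2 := hcen x y w
    rw [hg] at k1 k2
    simp only [L.add_right, L.smul_right, hxx, hyy, hz, hyx, zc, smul_zero, add_zero,
      zero_add] at k1 k2
    rw [hg] at k1
    obtain ⟨-, h1, h2, h3⟩ := li4_iff hli (s * p) (s * q) (-p + s * r) (s * s)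
      (by rw [← k1]; module)
    have hs : s = 0 := by simpa using h3
    subst hs
    have hp : p = 0 := by simpa using h2
    have hq : q = 0 := by simpa [hxy] using k2
    exact ⟨r, by rw [hg, hq, hp]; simp⟩
  refine heis_of_basis x y z (w - c • y + c' • x) ?_ hz (zc x) ?_ (zc y) ?_ ?_
  · apply li4
    intro p q r s h
    obtain ⟨h0, h1, rfl, rfl⟩ := li4_iff hli (p + s * c') (q - s * c) r s (by rw [← h]; module)
    exact ⟨by linarith, by linarith, rfl, rfl⟩
  · simp only [L.add_right, L.sub_right, L.smul_right, hc, hz, hxx]; module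
  · simp only [L.add_right, L.sub_right, L.smul_right, hc', hyx, hyy]; module
  · rw [L.skew, zc]; simp
    
theorem classify (L : LieStruct 4) (hL : L.IsNilpotent) :
    L.Iso abelian4 ∨ L.Iso heis4 ∨ L.Iso filiform4 := by
  by_cases h1 : ∀ x y, L.bracket x y = 0
  · exact Or.inl ⟨LinearEquiv.refl ℝ _, fun x y => by simp [h1, abelian4]⟩
  by_cases h2 : ∀ x y, L.bracket x (L.bracket x y) = 0
  · push Not at h1
    obtain ⟨x, y, h⟩ := h1
    exact Or.inr (Or.inl (heis_case h2 x y h))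
  · push Not at h2
    obtain ⟨x, y, h⟩ := h2
    exact Or.inr (Or.inr (filiform_case hL x y h))

theorem lcs_succ_le {n : ℕ} (L : LieStruct n) (k : ℕ) (W : Submodule ℝ (Fin n → ℝ))
    (h : ∀ x y, y ∈ lcs L k → L.bracket x y ∈ W) : lcs L (k + 1) ≤ W := by
  rw [lcs, Submodule.span_le]
  rintro z ⟨x, y, hy, rfl⟩
  exact h x y hy

theorem bracket_mem_lcs {n : ℕ} (L : LieStruct n) (k : ℕ) (x y : Fin n → ℝ)
    (h : y ∈ lcs L k) : L.bracket x y ∈ lcs L (k + 1) := by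
  rw [lcs]
  exact Submodule.subset_span ⟨x, y, h, rfl⟩

/-- Vectors of `ℝ⁴` whose first two coordinates vanish. -/
def tail2 : Submodule ℝ (Fin 4 → ℝ) where
  carrier := {v | v 0 = 0 ∧ v 1 = 0}
  add_mem' := by rintro a b ⟨h1, h2⟩ ⟨h3, h4⟩; simp [*]
  zero_mem' := by simp
  smul_mem' := by rintro c a ⟨h1, h2⟩; simp [*]

/-- Vectors of `ℝ⁴` whose first three coordinates vanish. -/
def tail3 : Submodule ℝ (Fin 4 → ℝ) where
  carrier := {v | v 0 = 0 ∧ v 1 = 0 ∧ v 2 = 0}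
  add_mem' := by rintro a b ⟨h1, h2, h5⟩ ⟨h3, h4, h6⟩; simp [*]
  zero_mem' := by simp
  smul_mem' := by rintro c a ⟨h1, h2, h3⟩; simp [*]

theorem lcs_abelian : lcs abelian4 1 = ⊥ :=
  le_bot_iff.mp (lcs_succ_le _ _ _ fun x y _ => by simp [abelian4])

theorem lcs_heis : lcs heis4 2 = ⊥ := by
  have h1 : lcs heis4 1 ≤ tail2 := lcs_succ_le _ _ _ fun x y _ => ⟨rfl, rfl⟩
  refine le_bot_iff.mp (lcs_succ_le _ _ _ fun x y hy => ?_)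
  obtain ⟨h0, h1⟩ := h1 hy
  simp [heis4, h0, h1]

theorem lcs_filiform : lcs filiform4 3 = ⊥ := by
  have h1 : lcs filiform4 1 ≤ tail2 := lcs_succ_le _ _ _ fun x y _ => ⟨rfl, rfl⟩
  have h2 : lcs filiform4 2 ≤ tail3 := lcs_succ_le _ _ _ fun x y hy => by
    obtain ⟨h0, h1⟩ := h1 hy
    exact ⟨rfl, rfl, by simp [filiform4, h0, h1]⟩
  refine le_bot_iff.mp (lcs_succ_le _ _ _ fun x y hy => ?_)
  obtain ⟨h0, h1, h2⟩ := h2 hy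
  simp [filiform4, h0, h1, h2]

theorem lcs_heis_ne : lcs heis4 1 ≠ ⊥ := by
  intro h
  have := bracket_mem_lcs heis4 0 ![1, 0, 0, 0] ![0, 1, 0, 0] trivial
  rw [h] at this
  simp [heis4] at this

theorem lcs_filiform_ne : lcs filiform4 2 ≠ ⊥ := by
  intro h
  have := bracket_mem_lcs filiform4 1 ![1, 0, 0, 0] _
    (bracket_mem_lcs filiform4 0 ![1, 0, 0, 0] ![0, 1, 0, 0] trivial)
  rw [h] at this
  simp [filiform4] at this

theorem not_ab_heis : ¬ abelian4.Iso heis4 := by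
  rintro ⟨f, hf⟩
  have := hf (f.symm ![1, 0, 0, 0]) (f.symm ![0, 1, 0, 0])
  simp [heis4, abelian4] at this
  simpa using congrFun this 2

theorem not_ab_fil : ¬ abelian4.Iso filiform4 := by
  rintro ⟨f, hf⟩
  have := hf (f.symm ![1, 0, 0, 0]) (f.symm ![0, 1, 0, 0])
  simp [filiform4, abelian4] at this
  simpa using congrFun this 2

theorem not_heis_fil : ¬ heis4.Iso filiform4 := by
  rintro ⟨f, hf⟩
  have h := hf (f.symm ![1, 0, 0, 0])
    (heis4.bracket (f.symm ![1, 0, 0, 0]) (f.symm ![0, 1, 0, 0]))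
  have h0 : ∀ x y z, heis4.bracket x (heis4.bracket y z) = 0 := by
    intro x y z; simp [heis4]
  rw [h0, hf] at h
  have h3 := congrFun h 3
  simp [filiform4] at h3

theorem card_classes : Nat.card (Quot (IsoOn (n := 4) fun L => L.IsNilpotent)) = 3 := by
  have heq : Equivalence (IsoOn (n := 4) fun L => L.IsNilpotent) :=
    ⟨fun L => LieStruct.Iso.refl L.1, fun h => LieStruct.Iso.symm h,
      fun h h' => LieStruct.Iso.trans h h'⟩
  let r : Fin 3 → {L : LieStruct 4 // L.IsNilpotent} :=
    ![⟨abelian4, 1, lcs_abelian⟩, ⟨heis4, 2, lcs_heis⟩, ⟨filiform4, 3, lcs_filiform⟩]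
  have hbij : Function.Bijective
      fun i => Quot.mk (IsoOn (n := 4) fun L => L.IsNilpotent) (r i) := by
    constructor
    · intro i j hij
      have hij : (r i).1.Iso (r j).1 := heq.quot_mk_eq_iff _ _ |>.mp hij
      fin_cases i <;> fin_cases j <;> first
        | rfl
        | exact absurd hij not_ab_heis
        | exact absurd hij not_ab_fil
        | exact absurd hij not_heis_fil
        | exact absurd hij.symm not_ab_heis
        | exact absurd hij.symm not_ab_fil
        | exact absurd hij.symm not_heis_fil
    · intro q
      induction q using Quot.ind with
      | mk L =>
        rcases classify L.1 L.2 with h | h | h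
        · exact ⟨0, Quot.sound h.symm⟩
        · exact ⟨1, Quot.sound h.symm⟩
        · exact ⟨2, Quot.sound h.symm⟩
  rw [← Nat.card_eq_of_bijective _ hbij]
  simp

/-- There are exactly 3 isomorphism classes of real 4-dimensional nilpotent Lie algebras,
represented by the abelian algebra `ℝ⁴` (1-step), the direct sum of the Heisenberg
algebra with `ℝ` (2-step), and the filiform algebra with `[e₁,e₂] = e₃`, `[e₁,e₃] = e₄`
(3-step). -/
theorem nilpotent_four_dimensional_classification :
    Nat.card (Quot (IsoOn (n := 4) fun L => L.IsNilpotent)) = 3 ∧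
    (lcs abelian4 1 = ⊥ ∧ lcs abelian4 0 ≠ ⊥) ∧
    (lcs heis4 2 = ⊥ ∧ lcs heis4 1 ≠ ⊥) ∧
    (lcs filiform4 3 = ⊥ ∧ lcs filiform4 2 ≠ ⊥) ∧
    (¬ abelian4.Iso heis4 ∧ ¬ abelian4.Iso filiform4 ∧ ¬ heis4.Iso filiform4) ∧
    (∀ L : LieStruct 4, L.IsNilpotent →
      L.Iso abelian4 ∨ L.Iso heis4 ∨ L.Iso filiform4) := by
  refine ⟨card_classes, ⟨lcs_abelian, ?_⟩, ⟨lcs_heis, lcs_heis_ne⟩, ⟨lcs_filiform, lcs_filiform_ne⟩,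
    ⟨not_ab_heis, not_ab_fil, not_heis_fil⟩, classify⟩
  rw [lcs]
  exact top_ne_bot
end

section
/- Every real 4-dimensional nilpotent Lie algebra admits a symplectic structure, i.e. a nondegenerate alternating bilinear form ω satisfying ω([x,y], z) + ω([y,z], x) + ω([z,x], y) = 0 for all x, y, z. -/
theorem LieStruct.exists_next {n : ℕ} (L : LieStruct n) (h : L.IsNilpotent)
    (W : Submodule ℝ (Fin n → ℝ)) (hW : W ≠ ⊤) :
    ∃ v, v ∉ W ∧ ∀ x, L.bracket x v ∈ W := by
  classical
  have hex : ∃ k, lcs L k ≤ W := by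
    obtain ⟨k, hk⟩ := h
    exact ⟨k, hk ▸ bot_le⟩
  have hs := Nat.find_spec hex
  have hm := fun m => @Nat.find_min _ _ hex m
  generalize Nat.find hex = k at hs hm
  cases k with
  | zero => exact absurd (top_le_iff.mp hs) hW
  | succ k =>
    obtain ⟨v, hv, hvW⟩ := SetLike.not_le_iff_exists.mp (hm k (Nat.lt_succ_self k))
    exact ⟨v, hvW, fun x => hs (Submodule.subset_span ⟨x, v, hv, rfl⟩)⟩

theorem LieStruct.next_family (L : LieStruct 4) (h : L.IsNilpotent) {m : ℕ} (hm : m < 4)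
    (v : Fin m → (Fin 4 → ℝ)) (hv : LinearIndependent ℝ v) :
    ∃ w, LinearIndependent ℝ (Fin.cons w v : Fin (m + 1) → (Fin 4 → ℝ)) ∧
      ∀ x, L.bracket x w ∈ Submodule.span ℝ (Set.range v) := by
  have hW : Submodule.span ℝ (Set.range v) ≠ ⊤ := by
    intro ht
    have h1 := finrank_span_eq_card hv
    rw [ht, finrank_top] at h1
    simp at h1
    omega
  obtain ⟨w, hw, hb⟩ := L.exists_next h _ hW
  exact ⟨w, linearIndependent_finCons.mpr ⟨hv, hw⟩, hb⟩

theorem LieStruct.skew_s11 {n : ℕ} (L : LieStruct n) (x y : Fin n → ℝ) :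
    L.bracket y x = - L.bracket x y := by
  have h := L.alt (x + y)
  rw [L.add_left, L.add_right, L.add_right, L.alt, L.alt] at h
  simp only [zero_add, add_zero] at h
  exact eq_neg_of_add_eq_zero_right h

theorem LieStruct.exists_basis (L : LieStruct 4) (h : L.IsNilpotent) :
    ∃ (B : Module.Basis (Fin 4) ℝ (Fin 4 → ℝ)) (a b c d : ℝ),
      ∀ x y, L.bracket x y =
        (B.repr x 0 * B.repr y 1 - B.repr x 1 * B.repr y 0) • (a • B 2 + b • B 3) +
        (B.repr x 0 * B.repr y 2 - B.repr x 2 * B.repr y 0) • (c • B 3) +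
        (B.repr x 1 * B.repr y 2 - B.repr x 2 * B.repr y 1) • (d • B 3) := by
  obtain ⟨e3, i3, h3⟩ := L.next_family h (m := 0) (by norm_num) Fin.elim0
    linearIndependent_empty_type
  obtain ⟨e2, i2, h2⟩ := L.next_family h (by norm_num) _ i3
  obtain ⟨e1, i1, h1⟩ := L.next_family h (by norm_num) _ i2
  obtain ⟨e0, i0, -⟩ := L.next_family h (by norm_num) _ i1
  let B := basisOfLinearIndependentOfCardEqFinrank i0 (by simp)
  have b0 : B 0 = e0 := by simp [B]
  have b1 : B 1 = e1 := by simp [B]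
  have b2 : B 2 = e2 := by simp [B]; rfl
  have b3 : B 3 = e3 := by simp [B]; rfl
  have z3 : ∀ x, L.bracket x (B 3) = 0 := by
    intro x
    simpa [b3] using h3 x
  have z3' : ∀ x, L.bracket (B 3) x = 0 := by
    intro x
    rw [L.skew_s11 x, z3, neg_zero]
  have z2 : ∀ x, ∃ c : ℝ, L.bracket x (B 2) = c • B 3 := by
    intro x
    have := h2 x
    rw [Submodule.mem_span_range_iff_exists_fun] at this
    obtain ⟨c, hc⟩ := this
    refine ⟨c 0, ?_⟩
    rw [b2, b3, ← hc]
    simp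
  have z1 : ∀ x, ∃ a b : ℝ, L.bracket x (B 1) = a • B 2 + b • B 3 := by
    intro x
    have := h1 x
    rw [Submodule.mem_span_range_iff_exists_fun] at this
    obtain ⟨c, hc⟩ := this
    refine ⟨c 0, c 1, ?_⟩
    rw [b1, b2, b3, ← hc, Fin.sum_univ_two]
    rfl
  obtain ⟨a, b, hab⟩ := z1 (B 0)
  obtain ⟨c, hc⟩ := z2 (B 0)
  obtain ⟨d, hd⟩ := z2 (B 1)
  refine ⟨B, a, b, c, d, fun x y => ?_⟩
  have hx := B.sum_repr x
  have hy := B.sum_repr y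
  rw [Fin.sum_univ_four] at hx hy
  have hab' := L.skew_s11 (B 0) (B 1)
  have hc' := L.skew_s11 (B 0) (B 2)
  have hd' := L.skew_s11 (B 1) (B 2)
  rw [hab] at hab'
  rw [hc] at hc'
  rw [hd] at hd'
  conv_lhs => rw [← hx, ← hy]
  simp only [L.add_left, L.add_right, L.smul_left, L.smul_right, L.alt, z3, z3', hab, hc, hd,
    hab', hc', hd']
  module

/-- The alternating form with prescribed values on a basis (no `34` and `12` part). -/
noncomputable def formOf (B : Module.Basis (Fin 4) ℝ (Fin 4 → ℝ)) (p q r s : ℝ) :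
    (Fin 4 → ℝ) →ₗ[ℝ] (Fin 4 → ℝ) →ₗ[ℝ] ℝ :=
  LinearMap.mk₂ ℝ (fun x y =>
      p * (B.repr x 0 * B.repr y 2 - B.repr x 2 * B.repr y 0) +
      q * (B.repr x 1 * B.repr y 2 - B.repr x 2 * B.repr y 1) +
      r * (B.repr x 0 * B.repr y 3 - B.repr x 3 * B.repr y 0) +
      s * (B.repr x 1 * B.repr y 3 - B.repr x 3 * B.repr y 1))
    (by intros; simp only [map_add, Finsupp.add_apply]; ring)
    (by intros; simp only [map_smul, Finsupp.smul_apply, smul_eq_mul]; ring)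
    (by intros; simp only [map_add, Finsupp.add_apply]; ring)
    (by intros; simp only [map_smul, Finsupp.smul_apply, smul_eq_mul]; ring)

theorem admits_of (L : LieStruct 4) (B : Module.Basis (Fin 4) ℝ (Fin 4 → ℝ)) (a b c d : ℝ)
    (hB : ∀ x y, L.bracket x y =
        (B.repr x 0 * B.repr y 1 - B.repr x 1 * B.repr y 0) • (a • B 2 + b • B 3) +
        (B.repr x 0 * B.repr y 2 - B.repr x 2 * B.repr y 0) • (c • B 3) +
        (B.repr x 1 * B.repr y 2 - B.repr x 2 * B.repr y 1) • (d • B 3))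
    (p q r s : ℝ) (hpf : r * q - p * s ≠ 0) (hcl : d * r = c * s) :
    L.AdmitsSymplectic := by
  refine ⟨formOf B p q r s, ?_, ?_, ?_⟩
  · intro x
    simp only [formOf, LinearMap.mk₂_apply]
    ring
  · intro x hx
    have k0 := hx (B 0)
    have k1 := hx (B 1)
    have k2 := hx (B 2)
    have k3 := hx (B 3)
    simp [formOf, Finsupp.single_apply] at k0 k1 k2 k3
    have x0 : B.repr x 0 = 0 := by
      apply (mul_eq_zero.mp (?_ : (r * q - p * s) * B.repr x 0 = 0)).resolve_left hpf
      linear_combination q * k3 - s * k2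
    have x1 : B.repr x 1 = 0 := by
      apply (mul_eq_zero.mp (?_ : (r * q - p * s) * B.repr x 1 = 0)).resolve_left hpf
      linear_combination r * k2 - p * k3
    have x2 : B.repr x 2 = 0 := by
      apply (mul_eq_zero.mp (?_ : (r * q - p * s) * B.repr x 2 = 0)).resolve_left hpf
      linear_combination s * k0 - r * k1
    have x3 : B.repr x 3 = 0 := by
      apply (mul_eq_zero.mp (?_ : (r * q - p * s) * B.repr x 3 = 0)).resolve_left hpf
      linear_combination p * k1 - q * k0
    apply B.ext_elem
    intro i
    fin_cases i <;> simp [x0, x1, x2, x3]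
  · intro x y z
    simp only [hB, formOf, LinearMap.mk₂_apply, map_add, map_smul, Finsupp.add_apply,
      Finsupp.smul_apply, smul_eq_mul, Module.Basis.repr_self, Finsupp.single_apply]
    simp
    generalize B.repr x = x
    generalize B.repr y = y
    generalize B.repr z = z
    linear_combination (-(x 0 * (y 1 * z 2 - y 2 * z 1) - x 1 * (y 0 * z 2 - y 2 * z 0)
      + x 2 * (y 0 * z 1 - y 1 * z 0))) * hcl

/-- Every real 4-dimensional nilpotent Lie algebra admits a symplectic structure. -/
theorem four_dimensional_nilpotent_admits_symplectic :
    ∀ L : LieStruct 4, L.IsNilpotent → L.AdmitsSymplectic := by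
  intro L h
  obtain ⟨B, a, b, c, d, hB⟩ := L.exists_basis h
  by_cases hcd : c ^ 2 + d ^ 2 = 0
  · have hc : c = 0 := by nlinarith [sq_nonneg c, sq_nonneg d]
    have hd : d = 0 := by nlinarith [sq_nonneg c, sq_nonneg d]
    exact admits_of L B a b c d hB 0 1 1 0 (by norm_num) (by simp [hd])
  · refine admits_of L B a b c d hB (-d) c c d ?_ (by ring)
    intro h0
    exact hcd (by linear_combination h0)
end
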